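/- Assume the Case (B) setup with v3 = 0, v1 > 0, v2 > 0 and gcd(n1,n2,n3,n4) = 1, and assume moreover that a2 < a1, a3 < u1 + u2, v2 < a2 and a1 + v1 < a2 − v2 + a4. Let b = (a2·a3, a1·a3, a1·u2 + u1·a2, a2·a3). Then for every integer w ≥ 0 such that the four entries of n + w·b have greatest common divisor 1, the ideal I(n + w·b)_* equals the ideal of K[x1,x2,x3,x4] generated by x2^{a2}, x3^{a3}, x1^{v1+w}x2^{v2} and x1^{a1+v1+w}, and this ideal cannot be generated by fewer than 4 polynomials (i.e. it is an almost complete intersection). -/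

import Mathlib

open MvPolynomial

/-- The toric ideal of the monomial curve `(t^{n 0}, t^{n 1}, t^{n 2}, t^{n 3})`:
the kernel of the `K`-algebra map `K[x₁,x₂,x₃,x₄] → K[t]`, `xᵢ ↦ t^{n i}`. -/
noncomputable def toricIdeal (K : Type*) [Field K] (n : Fin 4 → ℕ) :
    Ideal (MvPolynomial (Fin 4) K) :=
  RingHom.ker (aeval (fun i => (Polynomial.X : Polynomial K) ^ n i) :
    MvPolynomial (Fin 4) K →ₐ[K] Polynomial K)

/-- The ideal `I_*` generated by the least-degree nonzero homogeneous components `f_*`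
of the nonzero elements `f ∈ I`. -/
noncomputable def idealStar {K : Type*} [Field K] (I : Ideal (MvPolynomial (Fin 4) K)) :
    Ideal (MvPolynomial (Fin 4) K) :=
  Ideal.span {g | ∃ f ∈ I, f ≠ 0 ∧ ∃ d : ℕ,
    (∀ e < d, homogeneousComponent e f = 0) ∧
    homogeneousComponent d f ≠ 0 ∧ g = homogeneousComponent d f}

/-- If finitely many monomials form an antichain, the ideal they generate has no smaller
generating set. -/
theorem card_le_card_of_span_monomial_eq {σ ι K : Type*} [Field K] [Fintype ι]
    (E : ι → σ →₀ ℕ) (hE : ∀ i j, E i ≤ E j → i = j) (s : Finset (MvPolynomial σ K))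
    (h : Ideal.span (Set.range fun i => monomial (E i) (1 : K)) = Ideal.span (s : Set _)) :
    Fintype.card ι ≤ s.card := by
  classical
  let φ : MvPolynomial σ K →ₗ[K] (ι → K) := LinearMap.pi fun i => lcoeff K (E i)
  have hφ (p : MvPolynomial σ K) (i : ι) : φ p i = coeff (E i) p := rfl
  have hmul : ∀ c p : MvPolynomial σ K,
      p ∈ Ideal.span (Set.range fun i => monomial (E i) (1 : K)) →
      φ (c * p) = coeff 0 c • φ p := by
    intro c p hp
    have hr : (Set.range fun i => monomial (E i) (1 : K)) =
        (fun e => monomial e (1 : K)) '' Set.range E := by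
      rw [← Set.range_comp]; rfl
    rw [hr, mem_ideal_span_monomial_image] at hp
    ext i
    rw [hφ, Pi.smul_apply, hφ, coeff_mul, smul_eq_mul]
    refine Finset.sum_eq_single (0, E i) ?_ ?_
    · rintro ⟨a, b⟩ hab hne
      rw [Finset.HasAntidiagonal.mem_antidiagonal] at hab
      dsimp only at hab ⊢
      by_cases hb : coeff b p = 0
      · rw [hb, mul_zero]
      obtain ⟨-, ⟨j, rfl⟩, hj⟩ := hp b (mem_support_iff.mpr hb)
      have hbi : b ≤ E i := hab ▸ le_add_self
      obtain rfl := hE j i (hj.trans hbi)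
      obtain rfl := le_antisymm hbi hj
      exact absurd (by rw [add_eq_right.mp hab]) hne
    · intro h0
      exact absurd (Finset.HasAntidiagonal.mem_antidiagonal.mpr (zero_add _)) h0
  have hmem : ∀ p ∈ Ideal.span (s : Set (MvPolynomial σ K)),
      φ p ∈ Submodule.span K ((s.image φ : Finset (ι → K)) : Set (ι → K)) := by
    intro p hp
    induction hp using Submodule.span_induction with
    | mem x hx => exact Submodule.subset_span (by simpa using ⟨x, hx, rfl⟩)
    | zero => simp
    | add x y _ _ hx hy => rw [map_add]; exact add_mem hx hy
    | smul c x hx ih =>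
      rw [smul_eq_mul, hmul c x (by rw [h]; exact hx)]
      exact Submodule.smul_mem _ _ ih
  have htop : Submodule.span K ((s.image φ : Finset (ι → K)) : Set (ι → K)) = ⊤ := by
    rw [eq_top_iff, ← (Pi.basisFun K ι).span_eq, Submodule.span_le]
    rintro _ ⟨i, rfl⟩
    have hi := hmem (monomial (E i) (1 : K)) (h ▸ Ideal.subset_span ⟨i, rfl⟩)
    have hbasis : φ (monomial (E i) (1 : K)) = Pi.basisFun K ι i := by
      ext j
      rw [hφ, coeff_monomial, Pi.basisFun_apply, Pi.single_apply]
      exact if_congr ⟨fun hj => (hE i j hj.le).symm, fun hj => by rw [hj]⟩ rfl rfl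
    rwa [hbasis] at hi
  have hrank := finrank_span_finset_le_card (R := K) (s.image φ)
  rw [Set.finrank, htop, finrank_top, Module.finrank_fintype_fun_eq_card] at hrank
  exact hrank.trans Finset.card_image_le

theorem aeval_X_pow_monomial {σ K : Type*} [Field K] (n : σ → ℕ) (m : σ →₀ ℕ) (c : K) :
    aeval (fun i => (Polynomial.X : Polynomial K) ^ n i) (monomial m c) =
      Polynomial.monomial (Finsupp.weight n m) c := by
  rw [aeval_monomial, Finsupp.weight_apply, ← Polynomial.C_mul_X_pow_eq_monomial,
    Finsupp.sum, ← Finset.prod_pow_eq_pow_sum, Finsupp.prod]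
  simp only [← pow_mul, smul_eq_mul, mul_comm]
  rfl

/-- On each fibre of the weight map, the coefficients of an element of the toric ideal
sum to zero. -/
theorem sum_coeff_eq_zero_of_mem_toricIdeal {K : Type*} [Field K] {n : Fin 4 → ℕ}
    {f : MvPolynomial (Fin 4) K} (hf : f ∈ toricIdeal K n) (W : ℕ) :
    ∑ m ∈ f.support, (if Finsupp.weight n m = W then coeff m f else 0) = 0 := by
  have h : aeval (fun i => (Polynomial.X : Polynomial K) ^ n i) f = 0 := hf
  rw [f.as_sum, map_sum] at h
  simp only [aeval_X_pow_monomial] at h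
  have hcoeff := congrArg (fun p => Polynomial.coeff p W) h
  simpa only [Polynomial.finsetSum_coeff, Polynomial.coeff_monomial,
    Polynomial.coeff_zero] using hcoeff

/-- Suppose the binomials `x ^ E i - x ^ E' i` lie in the toric ideal, with `x ^ E i` of smaller
degree, and each fibre of the weight map contains at most one monomial divisible by no `x ^ E i`.
Then the `x ^ E i` generate the ideal of initial forms. -/
theorem idealStar_toricIdeal_eq_span_monomial {K ι : Type*} [Field K] {n : Fin 4 → ℕ}
    (hn : ∀ j, 0 < n j) (E E' : ι → Fin 4 →₀ ℕ)
    (hwt : ∀ i, Finsupp.weight n (E i) = Finsupp.weight n (E' i))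
    (hdeg : ∀ i, (E i).degree < (E' i).degree)
    (huniq : ∀ s s' : Fin 4 →₀ ℕ, (∀ i, ¬E i ≤ s) → (∀ i, ¬E i ≤ s') →
      Finsupp.weight n s = Finsupp.weight n s' → s = s') :
    idealStar (toricIdeal K n) =
      Ideal.span (Set.range fun i => monomial (E i) (1 : K)) := by
  have hle (m : Fin 4 →₀ ℕ) : m.degree ≤ Finsupp.weight n m := by
    rw [Finsupp.weight_apply, Finsupp.degree_apply]
    exact Finset.sum_le_sum fun j _ => Nat.le_mul_of_pos_right _ (hn j)
  have hmax (s : Fin 4 →₀ ℕ) (hs : ∀ i, ¬E i ≤ s) : ∀ (k : ℕ) (m : Fin 4 →₀ ℕ),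
      Finsupp.weight n m = Finsupp.weight n s → Finsupp.weight n s - m.degree ≤ k →
      m ≠ s → m.degree < s.degree := by
    intro k
    induction k with
    | zero =>
      intro m hm hk hms
      by_contra hlt
      by_cases hst : ∀ i, ¬E i ≤ m
      · exact hms (huniq m s hst hs hm)
      push Not at hst
      obtain ⟨i, hi⟩ := hst
      obtain ⟨c, rfl⟩ := le_iff_exists_add.mp hi
      have h1 := hle (E' i + c)
      have h2 := hdeg i
      simp only [map_add, ← hwt] at *
      lia
    | succ k ih =>
      intro m hm hk hms
      by_cases hst : ∀ i, ¬E i ≤ m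
      · exact absurd (huniq m s hst hs hm) hms
      push Not at hst
      obtain ⟨i, hi⟩ := hst
      obtain ⟨c, rfl⟩ := le_iff_exists_add.mp hi
      have h2 := hdeg i
      have h3 := ih (E' i + c) (by simpa only [map_add, ← hwt] using hm)
        (by simp only [map_add] at *; lia)
      by_cases hc : E' i + c = s
      · rw [← hc]
        simp only [map_add]
        lia
      · have := h3 hc
        simp only [map_add] at *
        lia
  have hr : (Set.range fun i => monomial (E i) (1 : K)) =
      (fun e => monomial e (1 : K)) '' Set.range E := by
    rw [← Set.range_comp]; rfl
  apply le_antisymm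
  · refine Ideal.span_le.mpr ?_
    rintro _ ⟨f, hf, -, d, hlow, -, rfl⟩
    rw [SetLike.mem_coe, hr, mem_ideal_span_monomial_image]
    intro s hsupp
    rw [mem_support_iff, coeff_homogeneousComponent] at hsupp
    obtain ⟨hsd, hsf⟩ := ite_ne_right_iff.mp hsupp
    by_contra hcon
    have hs (i : ι) : ¬E i ≤ s := fun hi => hcon ⟨E i, ⟨i, rfl⟩, hi⟩
    have hsum := sum_coeff_eq_zero_of_mem_toricIdeal hf (Finsupp.weight n s)
    rw [Finset.sum_eq_single s, if_pos rfl] at hsum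
    · exact hsf hsum
    · intro m hm hms
      refine if_neg fun hw => ?_
      have hlt := hmax s hs _ m hw le_rfl hms
      have h0 := congrArg (coeff m) (hlow m.degree (hsd ▸ hlt))
      rw [coeff_homogeneousComponent, if_pos rfl, coeff_zero] at h0
      exact mem_support_iff.mp hm h0
    · intro hns
      exact absurd (mem_support_iff.mpr hsf) hns
  · refine Ideal.span_le.mpr ?_
    rintro _ ⟨i, rfl⟩
    have hcomp (e : ℕ) (he : e < (E' i).degree) :
        homogeneousComponent e (monomial (E i) (1 : K) - monomial (E' i) 1) =
          homogeneousComponent e (monomial (E i) (1 : K)) := by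
      rw [map_sub, sub_eq_self]
      ext m
      rw [coeff_homogeneousComponent, coeff_monomial, coeff_zero]
      grind
    have hself : homogeneousComponent (E i).degree (monomial (E i) (1 : K)) =
        monomial (E i) 1 :=
      homogeneousComponent_of_mem (isHomogeneous_monomial _ rfl) |>.trans (if_pos rfl)
    have hne : monomial (E i) (1 : K) ≠ 0 := by simp
    refine Ideal.subset_span ⟨monomial (E i) 1 - monomial (E' i) 1, ?_, ?_, (E i).degree,
      ?_, ?_, ?_⟩
    · rw [toricIdeal, RingHom.mem_ker]
      erw [map_sub, aeval_X_pow_monomial, aeval_X_pow_monomial]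
      rw [hwt, sub_self]
    · intro h0
      have := hcomp _ (hdeg i)
      rw [h0, hself, map_zero] at this
      exact hne this.symm
    · intro e he
      rw [hcomp e (he.trans (hdeg i))]
      ext m
      rw [coeff_homogeneousComponent, coeff_monomial, coeff_zero]
      grind
    · rwa [hcomp _ (hdeg i), hself]
    · rw [hcomp _ (hdeg i), hself]

/-- The translates of the L-shaped region `{(i, j) | i < a + v₁, j < b, i < v₁ ∨ j < v₂}` by the
lattice spanned by `(a, -b)` and `(v₁, v₂)` are disjoint. -/
theorem lShape_eq_of_sub_mem_lattice {a b v₁ v₂ i j i' j' p q : ℤ} (ha : 0 < a) (hb : 0 < b)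
    (hv₁ : 0 < v₁) (hv₂ : 0 < v₂) (hi : 0 ≤ i) (hj : 0 ≤ j) (hi' : 0 ≤ i') (hj' : 0 ≤ j')
    (hia : i < a + v₁) (hjb : j < b) (hij : i < v₁ ∨ j < v₂)
    (hia' : i' < a + v₁) (hjb' : j' < b) (hij' : i' < v₁ ∨ j' < v₂)
    (h1 : i - i' = p * a - q * v₁) (h2 : j - j' = -p * b - q * v₂) : p = 0 ∧ q = 0 := by
  have key {i j i' j' p q : ℤ} (hi' : 0 ≤ i') (hj' : 0 ≤ j')
      (hia : i < a + v₁) (hjb : j < b) (hij : i < v₁ ∨ j < v₂)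
      (h1 : i - i' = p * a + q * v₁) (h2 : j - j' = -p * b + q * v₂) (hq : 0 < q) : False := by
    have hqv₁ : v₁ ≤ q * v₁ := le_mul_of_one_le_left hv₁.le hq
    have hqv₂ : v₂ ≤ q * v₂ := le_mul_of_one_le_left hv₂.le hq
    rcases lt_trichotomy p 0 with hp | rfl | hp
    · have : b ≤ -p * b := le_mul_of_one_le_left hb.le (by lia)
      lia
    · lia
    · have : a ≤ p * a := le_mul_of_one_le_left ha.le hp
      lia
  rcases lt_trichotomy q 0 with hq | rfl | hq
  · exact (key (p := p) (q := -q) hi' hj' hia hjb hij (by linarith) (by linarith)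
      (by lia)).elim
  · refine ⟨?_, rfl⟩
    rcases lt_trichotomy p 0 with hp | rfl | hp
    · have : b ≤ -p * b := le_mul_of_one_le_left hb.le (by lia)
      lia
    · rfl
    · have : b ≤ p * b := le_mul_of_one_le_left hb.le hp
      lia
  · exact (key (p := -p) (q := q) hi hj hia' hjb' hij' (by linarith) (by linarith) hq).elim

/-- Two monomials of equal weight coincide if their exponents lie in the box of height `a3` over
an L-shaped region. -/
theorem exponents_eq_of_weight_eq {a1 a2 a3 a4 u1 u2 v1 v2 : ℕ}
    (ha1 : 0 < a1) (ha2 : 0 < a2) (ha3 : 0 < a3) (ha4 : 0 < a4) (hv1 : 0 < v1) (hv2 : 0 < v2)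
    (hgcd : ∀ d : ℕ, d ∣ a2 * a3 * a4 → d ∣ a1 * a3 * a4 → d ∣ a4 * (a1 * u2 + u1 * a2) →
      d ∣ a3 * (a1 * v2 + v1 * a2) → d = 1)
    {i j k l i' j' k' l' : ℕ} (hi : i < a1 + v1) (hj : j < a2) (hk : k < a3)
    (hij : i < v1 ∨ j < v2) (hi' : i' < a1 + v1) (hj' : j' < a2) (hk' : k' < a3)
    (hij' : i' < v1 ∨ j' < v2)
    (hw : i * (a2 * a3 * a4) + j * (a1 * a3 * a4) + k * (a4 * (a1 * u2 + u1 * a2)) +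
        l * (a3 * (a1 * v2 + v1 * a2)) =
      i' * (a2 * a3 * a4) + j' * (a1 * a3 * a4) + k' * (a4 * (a1 * u2 + u1 * a2)) +
        l' * (a3 * (a1 * v2 + v1 * a2))) :
    i = i' ∧ j = j' ∧ k = k' ∧ l = l' := by
  have hc3 : Nat.Coprime a3 (a4 * (a1 * u2 + u1 * a2)) :=
    hgcd _ (((Nat.gcd_dvd_left _ _).mul_left _).mul_right _)
      (((Nat.gcd_dvd_left _ _).mul_left _).mul_right _) (Nat.gcd_dvd_right _ _)
      ((Nat.gcd_dvd_left _ _).mul_right _)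
  have hc4 : Nat.Coprime a4 (a3 * (a1 * v2 + v1 * a2)) :=
    hgcd _ ((Nat.gcd_dvd_left _ _).mul_left _) ((Nat.gcd_dvd_left _ _).mul_left _)
      ((Nat.gcd_dvd_left _ _).mul_right _) (Nat.gcd_dvd_right _ _)
  have hc12 : Nat.Coprime a1 a2 :=
    hgcd _ (((Nat.gcd_dvd_right _ _).mul_right _).mul_right _)
      (((Nat.gcd_dvd_left _ _).mul_right _).mul_right _)
      ((((Nat.gcd_dvd_left _ _).mul_right _).add ((Nat.gcd_dvd_right _ _).mul_left _)).mul_left _)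
      ((((Nat.gcd_dvd_left _ _).mul_right _).add ((Nat.gcd_dvd_right _ _).mul_left _)).mul_left _)
  have hz : (i * (a2 * a3 * a4) + j * (a1 * a3 * a4) + k * (a4 * (a1 * u2 + u1 * a2)) +
        l * (a3 * (a1 * v2 + v1 * a2)) : ℤ) =
      i' * (a2 * a3 * a4) + j' * (a1 * a3 * a4) + k' * (a4 * (a1 * u2 + u1 * a2)) +
        l' * (a3 * (a1 * v2 + v1 * a2)) := by exact_mod_cast hw
  have hc3z : IsCoprime (a3 : ℤ) (a4 * (a1 * u2 + u1 * a2)) := by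
    exact_mod_cast Nat.isCoprime_iff_coprime.mpr hc3
  have hc4z : IsCoprime (a4 : ℤ) (a3 * (a1 * v2 + v1 * a2)) := by
    exact_mod_cast Nat.isCoprime_iff_coprime.mpr hc4
  have hc12z : IsCoprime (a1 : ℤ) a2 := Nat.isCoprime_iff_coprime.mpr hc12
  have hkk : k = k' := by
    have hd : (a3 : ℤ) ∣ k - k' := by
      refine hc3z.dvd_of_dvd_mul_right (?_ : _ ∣ _ * _)
      exact ⟨-((i - i') * (a2 * a4) + (j - j') * (a1 * a4) + (l - l') * (a1 * v2 + v1 * a2)),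
        by linear_combination hz⟩
    have := Int.eq_zero_of_abs_lt_dvd hd (by rw [abs_lt]; lia)
    lia
  subst hkk
  obtain ⟨q, hq⟩ : (a4 : ℤ) ∣ l - l' := by
    refine hc4z.dvd_of_dvd_mul_right (?_ : _ ∣ _ * _)
    exact ⟨-((i - i') * (a2 * a3) + (j - j') * (a1 * a3)), by linear_combination hz⟩
  have ha3z : (a3 : ℤ) ≠ 0 := by positivity
  have ha4z : (a4 : ℤ) ≠ 0 := by positivity
  have ha1z : (a1 : ℤ) ≠ 0 := by positivity
  have hlin : (a2 : ℤ) * (i - i' + q * v1) + a1 * (j - j' + q * v2) = 0 := by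
    refine mul_left_cancel₀ (mul_ne_zero ha3z ha4z) ?_
    linear_combination hz - (a3 : ℤ) * (a1 * v2 + v1 * a2) * hq
  obtain ⟨p, hp⟩ : (a1 : ℤ) ∣ i - i' + q * v1 :=
    hc12z.dvd_of_dvd_mul_left ⟨-(j - j' + q * v2), by linear_combination hlin⟩
  have hp' : (j - j' + q * v2 : ℤ) = -p * a2 := by
    refine mul_left_cancel₀ ha1z ?_
    linear_combination hlin - (a2 : ℤ) * hp
  obtain ⟨rfl, rfl⟩ := lShape_eq_of_sub_mem_lattice (a := a1) (b := a2) (v₁ := v1) (v₂ := v2)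
    (i := i) (j := j) (i' := i') (j' := j') (p := p) (q := q)
    (by lia) (by lia) (by lia) (by lia) (by lia) (by lia) (by lia) (by lia) (by lia) (by lia)
    (by lia) (by lia) (by lia) (by lia) (by linear_combination hp) (by linear_combination hp')
  lia

theorem stmt16 (K : Type*) [Field K] (a1 a2 a3 a4 u1 u2 v1 v2 v3 : ℕ)
    (ha1 : 0 < a1) (ha2 : 0 < a2) (ha3 : 0 < a3) (ha4 : 0 < a4)
    (hu12 : ¬(u1 = 0 ∧ u2 = 0)) (hv123 : ¬(v1 = 0 ∧ v2 = 0 ∧ v3 = 0))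
    (n : Fin 4 → ℕ)
    (hn : n = ![a2 * a3 * a4, a1 * a3 * a4, a4 * (a1 * u2 + u1 * a2),
      v3 * (a1 * u2 + a2 * u1) + a3 * (a1 * v2 + v1 * a2)])
    (hv3 : v3 = 0) (hv1 : 0 < v1) (hv2 : 0 < v2)
    (hgcd : Nat.gcd (Nat.gcd (Nat.gcd (n 0) (n 1)) (n 2)) (n 3) = 1)
    (ha21 : a2 < a1) (ha3u : a3 < u1 + u2) (hv2a2 : v2 < a2)
    (hineq : a1 + v1 < a2 - v2 + a4)
    (b : Fin 4 → ℕ)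
    (hb : b = ![a2 * a3, a1 * a3, a1 * u2 + u1 * a2, a2 * a3]) :
    ∀ w : ℕ,
      Nat.gcd (Nat.gcd (Nat.gcd (n 0 + w * b 0) (n 1 + w * b 1))
        (n 2 + w * b 2)) (n 3 + w * b 3) = 1 →
      idealStar (toricIdeal K (fun j => n j + w * b j)) =
        Ideal.span {(X 1 : MvPolynomial (Fin 4) K) ^ a2, X 2 ^ a3,
          X 0 ^ (v1 + w) * X 1 ^ v2, X 0 ^ (a1 + v1 + w)} ∧
      ¬∃ s : Finset (MvPolynomial (Fin 4) K), s.card < 4 ∧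
        idealStar (toricIdeal K (fun j => n j + w * b j)) =
          Ideal.span (s : Set (MvPolynomial (Fin 4) K)) := by
  intro w hw
  subst hn hb hv3
  have hN : (fun j => (![a2 * a3 * a4, a1 * a3 * a4, a4 * (a1 * u2 + u1 * a2),
      0 * (a1 * u2 + a2 * u1) + a3 * (a1 * v2 + v1 * a2)] : Fin 4 → ℕ) j +
      w * (![a2 * a3, a1 * a3, a1 * u2 + u1 * a2, a2 * a3] : Fin 4 → ℕ) j) =
      ![a2 * a3 * (a4 + w), a1 * a3 * (a4 + w), (a4 + w) * (a1 * u2 + u1 * a2),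
        a3 * (a1 * v2 + (v1 + w) * a2)] := by
    funext j
    fin_cases j <;> simp <;> ring
  have hd : ∀ d : ℕ, d ∣ a2 * a3 * (a4 + w) → d ∣ a1 * a3 * (a4 + w) →
      d ∣ (a4 + w) * (a1 * u2 + u1 * a2) → d ∣ a3 * (a1 * v2 + (v1 + w) * a2) → d = 1 := by
    intro d h0 h1 h2 h3
    rw [← Nat.dvd_one, ← hw]
    refine Nat.dvd_gcd (Nat.dvd_gcd (Nat.dvd_gcd ?_ ?_) ?_) ?_
    · exact (congrFun hN 0).symm ▸ h0
    · exact (congrFun hN 1).symm ▸ h1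
    · exact (congrFun hN 2).symm ▸ h2
    · exact (congrFun hN 3).symm ▸ h3
  rw [hN]
  let E : Fin 4 → Fin 4 →₀ ℕ := ![Finsupp.single 1 a2, Finsupp.single 2 a3,
    Finsupp.single 0 (v1 + w) + Finsupp.single 1 v2, Finsupp.single 0 (a1 + v1 + w)]
  let E' : Fin 4 → Fin 4 →₀ ℕ := ![Finsupp.single 0 a1,
    Finsupp.single 0 u1 + Finsupp.single 1 u2, Finsupp.single 3 (a4 + w),
    Finsupp.single 1 (a2 - v2) + Finsupp.single 3 (a4 + w)]
  have hspan : Ideal.span (Set.range fun i => monomial (E i) (1 : K)) =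
      Ideal.span {(X 1 : MvPolynomial (Fin 4) K) ^ a2, X 2 ^ a3,
          X 0 ^ (v1 + w) * X 1 ^ v2, X 0 ^ (a1 + v1 + w)} := by
    congr 1
    ext p
    simp [E, Fin.exists_fin_succ, X_pow_eq_monomial, monomial_mul, eq_comm]
  have hA : 0 < a1 * u2 + u1 * a2 := by
    rcases Nat.eq_zero_or_pos u1 with h | h
    · have : 0 < u2 := by lia
      positivity
    · positivity
  have hstar := idealStar_toricIdeal_eq_span_monomial (K := K)
    (n := ![a2 * a3 * (a4 + w), a1 * a3 * (a4 + w), (a4 + w) * (a1 * u2 + u1 * a2),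
        a3 * (a1 * v2 + (v1 + w) * a2)]) ?_ E E' ?_ ?_ ?_
  · refine ⟨hstar.trans hspan, ?_⟩
    rintro ⟨s, hs, hs'⟩
    refine hs.not_ge ?_
    have := card_le_card_of_span_monomial_eq E ?_ s (hstar.symm.trans hs')
    · simpa using this
    · intro i j hij
      have h0 := hij 0
      have h1 := hij 1
      have h2 := hij 2
      fin_cases i <;> fin_cases j <;> simp [E] at h0 h1 h2 ⊢ <;> lia
  · intro j
    fin_cases j <;> simp <;> lia
  · obtain ⟨c, rfl⟩ := Nat.exists_eq_add_of_lt hv2a2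
    have hc : v2 + c + 1 - v2 = c + 1 := by lia
    intro i
    fin_cases i <;> simp [E, E', Finsupp.weight_single, hc] <;> ring
  · intro i
    fin_cases i <;> simp [E, E', -Finsupp.single_tsub] <;> lia
  · intro s s' hs hs' hss
    have hstd : ∀ m : Fin 4 →₀ ℕ, (∀ i, ¬E i ≤ m) → m 0 < a1 + (v1 + w) ∧ m 1 < a2 ∧
        m 2 < a3 ∧ (m 0 < v1 + w ∨ m 1 < v2) := by
      intro m hm
      have h0 := hm 0
      have h1 := hm 1
      have h2 := hm 2
      have h3 := hm 3
      simp [E, Finsupp.le_def, Fin.forall_fin_succ, Finsupp.single_apply] at h0 h1 h2 h3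
      lia
    obtain ⟨h0, h1, h2, h3⟩ := hstd s hs
    obtain ⟨h0', h1', h2', h3'⟩ := hstd s' hs'
    simp only [Finsupp.weight_eq_sum, Fin.sum_univ_four, smul_eq_mul] at hss
    obtain ⟨e0, e1, e2, e3⟩ := exponents_eq_of_weight_eq ha1 ha2 ha3 (by lia) (by lia) hv2 hd
      h0 h1 h2 h3 h0' h1' h2' h3' hss
    ext j
    fin_cases j <;> assumption
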